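/- Let I be a Z-lattice in an étale algebra K over the fraction field of a Dedekind domain Z. Then the double trace dual recovers I: (I^t)^t = I. -/

import Mathlib

universe u

/-- A `Z`-lattice in `K`: a finitely generated `Z`-submodule containing a `Q`-basis of `K`. -/
def IsLat (Z : Type*) (Q K : Type u) [CommRing Z] [Field Q] [Algebra Z Q]
    [CommRing K] [Algebra Q K] [Algebra Z K] (I : Submodule Z K) : Prop :=
  I.FG ∧ Submodule.span Q (I : Set K) = ⊤

variable (Z : Type*) (Q K : Type u) [CommRing Z] [IsDedekindDomain Z] [Field Q]
  [Algebra Z Q] [IsFractionRing Z Q] [CommRing K] [Algebra Q K] [Algebra Z K]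
  [IsScalarTower Z Q K] [FiniteDimensional Q K] [Algebra.Etale Q K]

/-- The trace dual `I^t = {a ∈ K : Tr_{K/Q}(aI) ⊆ Z}` of a `Z`-submodule of `K`. -/
def tdual (I : Submodule Z K) : Submodule Z K where
  carrier := {a | ∀ x ∈ I, Algebra.trace Q K (a * x) ∈ (algebraMap Z Q).range}
  add_mem' := by
    intro a b ha hb x hx
    rw [add_mul, map_add]
    exact add_mem (ha x hx) (hb x hx)
  zero_mem' := by
    intro x hx
    simp only [zero_mul, map_zero]
    exact zero_mem _
  smul_mem' := by
    intro z a ha x hx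
    have h1 : (z • a) * x = a * (z • x) := by
      rw [smul_mul_assoc, mul_comm a x, ← smul_mul_assoc, mul_comm]
    rw [h1]
    exact ha (z • x) (I.smul_mem z hx)

open scoped nonZeroDivisors

theorem Algebra.trace_pi_single {F ι : Type*} [Field F] [Finite ι] [DecidableEq ι] (A : ι → Type*)
    [∀ i, CommRing (A i)] [∀ i, Algebra F (A i)] [∀ i, Module.Finite F (A i)] (i : ι) (c : A i) :
    Algebra.trace F (∀ j, A j) (Pi.single i c) = Algebra.trace F (A i) c := by
  have h₁ : LinearMap.mul F (∀ j, A j) (Pi.single i c) =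
      LinearMap.single F A i ∘ₗ (LinearMap.mul F (A i) c ∘ₗ LinearMap.proj i) := by
    refine LinearMap.ext fun x ↦ ?_
    simp [Pi.single_mul_left]
  have h₂ : (LinearMap.mul F (A i) c ∘ₗ LinearMap.proj i) ∘ₗ LinearMap.single F A i =
      LinearMap.mul F (A i) c := by
    refine LinearMap.ext fun x ↦ ?_
    simp
  calc LinearMap.trace F _ (LinearMap.mul F (∀ j, A j) (Pi.single i c))
      = LinearMap.trace F _ (LinearMap.mul F (A i) c) := by
        rw [h₁, LinearMap.trace_comp_comm', h₂]

/-- The trace form of an étale algebra over a field is nondegenerate. -/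
theorem Algebra.Etale.traceForm_nondegenerate (F A : Type u) [Field F] [CommRing A] [Algebra F A]
    [Algebra.Etale F A] : (Algebra.traceForm F A).Nondegenerate := by
  classical
  obtain ⟨ι, _, B, _, _, e, hB⟩ := (Algebra.Etale.iff_exists_algEquiv_prod F A).mp inferInstance
  have _ (i) : Module.Finite F (B i) := (hB i).1
  have _ (i) : Algebra.IsSeparable F (B i) := (hB i).2
  refine (LinearMap.IsRefl.nondegenerate_iff_separatingLeft (B := Algebra.traceForm F A)
    (Algebra.traceForm_isSymm F).isRefl).mpr fun x hx ↦ ?_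
  rw [← map_eq_zero_iff e e.injective]
  funext i
  refine (_root_.traceForm_nondegenerate F (B i)).1 _ fun c ↦ ?_
  have h := hx (e.symm (Pi.single i c))
  rw [Algebra.traceForm_apply, ← Algebra.trace_eq_of_algEquiv e, map_mul, e.apply_symm_apply,
    ← Pi.single_mul_right, Algebra.trace_pi_single] at h
  exact h

/-- A submodule over a domain that spans a vector space over the fraction field
has this vector space as its localization. -/
theorem Submodule.isLocalizedModule_subtype_of_span_eq_top {R F V : Type*} [CommRing R] [IsDomain R]
    [Field F] [Algebra R F] [IsFractionRing R F] [AddCommGroup V] [Module R V] [Module F V]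
    [IsScalarTower R F V] (I : Submodule R V) (hI : Submodule.span F (I : Set V) = ⊤) :
    IsLocalizedModule R⁰ I.subtype where
  map_units s := by
    have h := (IsLocalization.map_units F s).map (Algebra.lsmul R (A := F) R V)
    convert h
    ext v
    simp
  surj y := by
    have hy : y ∈ Submodule.span F (I : Set V) := hI ▸ Submodule.mem_top
    suffices h : ∃ s : R⁰, s • y ∈ I from h.elim fun s hs ↦ ⟨(⟨_, hs⟩, s), rfl⟩
    induction hy using Submodule.span_induction with
    | mem x hx => exact ⟨1, by simpa using hx⟩
    | zero => exact ⟨1, by simp⟩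
    | add x y _ _ hx hy =>
      obtain ⟨s, hs⟩ := hx
      obtain ⟨t, ht⟩ := hy
      refine ⟨s * t, ?_⟩
      rw [smul_add]
      refine I.add_mem ?_ ?_
      · rw [mul_comm, mul_smul]
        exact I.smul_mem _ hs
      · rw [mul_smul]
        exact I.smul_mem _ ht
    | smul a x _ hx =>
      obtain ⟨s, hs⟩ := hx
      obtain ⟨⟨r, t⟩, h⟩ := IsLocalization.surj R⁰ a
      refine ⟨t * s, ?_⟩
      have h' : (t * s) • a • x = r • s • x := by
        simp only [Submonoid.smul_def, Submonoid.coe_mul, ← algebraMap_smul F (_ : R) (_ : V),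
          smul_smul, map_mul, ← h]
        ring_nf
      rw [h']
      exact I.smul_mem _ hs
  exists_of_eq h := ⟨1, by rw [Subtype.ext h]⟩

/-- A linear form on a lattice extends to a linear form on the ambient vector space. -/
theorem Submodule.exists_dual_extension_of_span_eq_top {R F V : Type*} [CommRing R] [IsDomain R]
    [Field F] [Algebra R F] [IsFractionRing R F] [AddCommGroup V] [Module R V] [Module F V]
    [IsScalarTower R F V] (I : Submodule R V) (hI : Submodule.span F (I : Set V) = ⊤)
    (f : Module.Dual R I) :
    ∃ g : Module.Dual F V, ∀ x : I, g x = algebraMap R F (f x) := by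
  have := I.isLocalizedModule_subtype_of_span_eq_top hI
  have hu (s : R⁰) : IsUnit (algebraMap R (Module.End R F) s) :=
    IsLocalizedModule.map_units (Algebra.linearMap R F) s
  refine ⟨(IsLocalizedModule.lift R⁰ I.subtype
    (Algebra.linearMap R F ∘ₗ f) hu).extendScalarsOfIsLocalization R⁰ F, fun x ↦ ?_⟩
  exact IsLocalizedModule.lift_apply R⁰ I.subtype (Algebra.linearMap R F ∘ₗ f) hu x

/-- For a `Z`-lattice `I` in the étale algebra `K`, the double trace dual recovers `I`. -/
theorem traceDual_traceDual (I : Submodule Z K) (hI : IsLat Z Q K I) :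
    tdual Z Q K (tdual Z Q K I) = I := by
  refine le_antisymm (fun y hy ↦ ?_) fun x hx a ha ↦ mul_comm a x ▸ ha x hx
  obtain ⟨hfg, hspan⟩ := hI
  have : Module.Finite Z I := Module.Finite.iff_fg.mpr hfg
  have : Module.IsTorsionFree Z K := Module.IsTorsionFree.trans_faithfulSMul Z Q K
  have : Module.FinitePresentation Z I := Module.finitePresentation_of_finite Z I
  have : Module.Projective Z I := Module.Flat.projective_of_finitePresentation
  obtain ⟨n, f, g, -, -, hfg⟩ := Module.Finite.exists_comp_eq_id_of_projective Z I
  choose G hG using fun i ↦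
    I.exists_dual_extension_of_span_eq_top hspan (LinearMap.proj i ∘ₗ g)
  have hnd := Algebra.Etale.traceForm_nondegenerate Q K
  let a (i : Fin n) : K := ((Algebra.traceForm Q K).toDual hnd).symm (G i)
  have ha (i : Fin n) (x : K) : Algebra.trace Q K (a i * x) = G i x :=
    LinearMap.BilinForm.apply_toDual_symm_apply (hB := hnd) (G i) x
  have ha_mem (i : Fin n) : a i ∈ tdual Z Q K I := fun x hx ↦
    ⟨g ⟨x, hx⟩ i, by rw [ha]; exact (hG i ⟨x, hx⟩).symm⟩
  let b (i : Fin n) : I := f fun j ↦ if i = j then 1 else 0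
  have hsum (x : K) : ∑ i, G i x • (b i : K) = x := by
    let L : K →ₗ[Q] K := ∑ i, (G i).smulRight (b i : K)
    have hL : L = LinearMap.id := by
      refine LinearMap.ext_on hspan fun x hx ↦ ?_
      have h := congrArg (Subtype.val) (LinearMap.congr_fun hfg ⟨x, hx⟩)
      rw [LinearMap.comp_apply, LinearMap.pi_apply_eq_sum_univ f] at h
      simpa [L, b, fun i ↦ hG i ⟨x, hx⟩] using h
    simpa [L] using LinearMap.congr_fun hL x
  rw [← hsum y]
  refine I.sum_mem fun i _ ↦ ?_
  obtain ⟨z, hz⟩ := hy (a i) (ha_mem i)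
  rw [← ha, mul_comm, ← hz, algebraMap_smul]
  exact I.smul_mem z (b i).2
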